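/- Fix integers k and m with 1 ≤ k ≤ m−1. Then the sum, over all integer tuples (i₁, …, i_k) with −m+1 < i₁ < i₂ < ⋯ < i_k < m and |i_s − i_r| ≥ 2 whenever s ≠ r, of the product ∏_{s=1}^{k} ((2m−1)² − (2i_s − 1)²), equals the sum, over all integer tuples (j₁, …, j_k) with 1 ≤ j₁ < j₂ < ⋯ < j_k ≤ m−1, of the product ∏_{s=1}^{k} (4j_s)². -/

import Mathlib

open Finset Polynomial

/-- Homogenised continuants of the Sylvester-Kac matrix. -/
def kacK (N x y : ℤ) : ℕ → ℤ
  | 0 => 1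
  | 1 => x
  | (n + 2) => x * kacK N x y (n + 1) - y ^ 2 * ((n + 1 : ℕ) : ℤ) * (N - ((n + 1 : ℕ) : ℤ)) * kacK N x y n

lemma kacK_shift (N x y : ℤ) (n : ℕ) :
    kacK (N + 1) (x + y) y (n + 1) = kacK N x y (n + 1) + (n + 1) * y * kacK N x y n := by
  induction n using Nat.strong_induction_on with
  | _ n ih =>
    match n, ih with
    | 0, _ => simp [kacK]
    | 1, _ => simp [kacK]; ring
    | (n + 2), ih =>
      have h1 := ih (n + 1) (by omega)
      have h0 := ih n (by omega)
      rw [kacK, h1, h0]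
      have e3 : kacK N x y (n + 2 + 1) = x * kacK N x y (n + 2) - y ^ 2 * ((n + 2 : ℕ) : ℤ) * (N - ((n + 2 : ℕ) : ℤ)) * kacK N x y (n + 1) := by
        rw [kacK]
      have e2 : kacK N x y (n + 1 + 1) = x * kacK N x y (n + 1) - y ^ 2 * ((n + 1 : ℕ) : ℤ) * (N - ((n + 1 : ℕ) : ℤ)) * kacK N x y n := by
        rw [kacK]
      rw [e3]
      rw [show n + 1 + 1 = n + 2 from rfl] at *
      rw [e2]
      push_cast
      ring

lemma kacK_step (N : ℕ) (x y : ℤ) :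
    kacK ((N + 1 : ℕ) : ℤ) (x + y) y (N + 1) = (x + (N + 1) * y) * kacK N x y N := by
  push_cast
  rw [kacK_shift]
  cases N with
  | zero => simp [kacK]
  | succ N => rw [kacK]; ring

lemma kacK_prod (N : ℕ) (x y : ℤ) :
    kacK N x y N = ∏ i ∈ range N, (x + ((N : ℤ) - 1 - 2 * i) * y) := by
  induction N generalizing x with
  | zero => simp [kacK]
  | succ N ih =>
    have h := kacK_step N (x - y) y
    rw [sub_add_cancel] at h
    rw [h, ih, prod_range_succ', mul_comm]
    congr 1
    · refine prod_congr rfl fun i _ => ?_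
      push_cast; ring
    · push_cast; ring

lemma kacK_odd (M : ℕ) (x y : ℤ) :
    ∏ i ∈ range (2 * M + 1), (x + (2 * (M : ℤ) - 2 * i) * y)
      = x * ∏ j ∈ range M, (x ^ 2 - 4 * ((j : ℤ) + 1) ^ 2 * y ^ 2) := by
  induction M with
  | zero => simp
  | succ M ih =>
    rw [show 2 * (M + 1) + 1 = (2 * M + 1) + 1 + 1 by ring, prod_range_succ, prod_range_succ',
      prod_range_succ _ M, ← mul_assoc, ← ih]
    have : ∏ k ∈ range (2 * M + 1), (x + (2 * ((M + 1 : ℕ) : ℤ) - 2 * ((k + 1 : ℕ) : ℤ)) * y)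
        = ∏ i ∈ range (2 * M + 1), (x + (2 * (M : ℤ) - 2 * i) * y) :=
      prod_congr rfl fun i _ => by push_cast; ring
    rw [this]
    push_cast
    ring

/-- No two distinct entries are adjacent. -/
def SparseSet (A : Finset ℤ) : Prop := ∀ i ∈ A, ∀ j ∈ A, i ≠ j → 2 ≤ |i - j|

noncomputable instance : DecidablePred SparseSet := fun A =>
  inferInstanceAs (Decidable (∀ i ∈ A, ∀ j ∈ A, i ≠ j → 2 ≤ |i - j|))

/-- Weighted sum over sparse subsets. -/
noncomputable def sparseSum {R : Type*} [CommRing R] (w : ℤ → R) (a : ℤ) (n : ℕ) : R :=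
  ∑ A ∈ (Ioo a (a + n + 1)).powerset.filter SparseSet, ∏ i ∈ A, w i

lemma sparse_insert (a : ℤ) (n : ℕ) (A : Finset ℤ) (hA : A ⊆ Ioo a (a + n + 2)) :
    SparseSet (insert (a + n + 2) A) ↔ A ⊆ Ioo a (a + n + 1) ∧ SparseSet A := by
  constructor
  · intro h
    refine ⟨fun i hi => ?_, fun i hi j hj => h i (mem_insert_of_mem hi) j (mem_insert_of_mem hj)⟩
    have h1 := mem_Ioo.1 (hA hi)
    have h2 := h (a + n + 2) (mem_insert_self _ _) i (mem_insert_of_mem hi) (by omega)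
    rw [abs_of_pos (by omega)] at h2
    exact mem_Ioo.2 (by omega)
  · rintro ⟨hs, h⟩ i hi j hj hij
    rw [mem_insert] at hi hj
    rcases hi with rfl | hi <;> rcases hj with rfl | hj
    · exact absurd rfl hij
    · have := mem_Ioo.1 (hs hj)
      rw [abs_of_pos (by omega)]; omega
    · have := mem_Ioo.1 (hs hi)
      rw [abs_of_neg (by omega)]; omega
    · exact h i hi j hj hij

lemma sparseSum_succ {R : Type*} [CommRing R] (w : ℤ → R) (a : ℤ) (n : ℕ) :
    sparseSum w a (n + 2) = sparseSum w a (n + 1) + w (a + n + 2) * sparseSum w a n := by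
  have hI : Ioo a (a + (n + 2 : ℕ) + 1) = insert (a + n + 2) (Ioo a (a + n + 2)) := by
    ext i; simp only [mem_Ioo, mem_insert]; push_cast; omega
  have hI1 : Ioo a (a + (n + 1 : ℕ) + 1) = Ioo a (a + n + 2) := by
    congr 1; push_cast; ring
  have hn : a + n + 2 ∉ Ioo a (a + n + 2) := by simp
  unfold sparseSum
  rw [hI, hI1, sum_filter, sum_powerset_insert hn, ← sum_filter]
  congr 1
  rw [← sum_filter, mul_sum]
  have : (Ioo a (a + n + 2)).powerset.filter (fun A => SparseSet (insert (a + n + 2) A))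
      = (Ioo a (a + n + 1)).powerset.filter SparseSet := by
    ext A
    simp only [mem_filter, mem_powerset]
    constructor
    · rintro ⟨h1, h2⟩
      exact (sparse_insert a n A h1).1 h2
    · rintro ⟨h1, h2⟩
      have h3 : A ⊆ Ioo a (a + n + 2) := h1.trans (Ioo_subset_Ioo_right (by omega))
      exact ⟨h3, (sparse_insert a n A h3).2 ⟨h1, h2⟩⟩
  rw [this]
  refine sum_congr rfl fun A hA => ?_
  rw [prod_insert]
  intro h
  have := mem_Ioo.1 (mem_powerset.1 (mem_filter.1 hA).1 h)
  omega

lemma sparseSum_zero {R : Type*} [CommRing R] (w : ℤ → R) (a : ℤ) : sparseSum w a 0 = 1 := by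
  have : Ioo a (a + (0 : ℕ) + 1) = ∅ := by ext i; simp
  unfold sparseSum
  rw [this, powerset_empty, sum_filter, sum_singleton]
  simp [SparseSet]

lemma sparseSum_one {R : Type*} [CommRing R] (w : ℤ → R) (a : ℤ) :
    sparseSum w a 1 = 1 + w (a + 1) := by
  have : Ioo a (a + (1 : ℕ) + 1) = insert (a + 1) ∅ := by
    ext i; simp only [mem_Ioo, mem_insert, notMem_empty, or_false]; push_cast; omega
  unfold sparseSum
  rw [this, sum_filter, sum_powerset_insert (by simp)]
  simp [SparseSet]

lemma sparseSum_kacK (N a z : ℤ) (w : ℤ → ℤ)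
    (hw : ∀ p : ℤ, w (a + p) = -z ^ 2 * (4 * (p * (N - p)))) (n : ℕ) :
    sparseSum w a n = kacK N 1 (2 * z) (n + 1) := by
  induction n using Nat.strong_induction_on with
  | _ n ih =>
    match n, ih with
    | 0, _ => simp [kacK, sparseSum_zero]
    | 1, _ => rw [sparseSum_one, hw]; simp [kacK]; ring
    | (n + 2), ih =>
      have e : kacK N 1 (2 * z) (n + 2 + 1) = 1 * kacK N 1 (2 * z) (n + 1 + 1)
          - (2 * z) ^ 2 * ((n + 1 + 1 : ℕ) : ℤ) * (N - ((n + 1 + 1 : ℕ) : ℤ)) * kacK N 1 (2 * z) (n + 1) := by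
        rw [kacK]
      rw [sparseSum_succ, ih (n + 1) (by omega), ih n (by omega), e, add_assoc a, hw]
      push_cast
      ring

lemma eval_sparseSum (v : ℤ → ℤ) (a : ℤ) (n : ℕ) (t : ℤ) :
    (sparseSum (fun i => X * C (v i)) a n).eval t = sparseSum (fun i => t * v i) a n := by
  simp [sparseSum, eval_finset_sum, eval_prod]

lemma coeff_sum_prod (v : ℤ → ℤ) (S : Finset (Finset ℤ)) (k : ℕ) :
    (∑ A ∈ S, ∏ i ∈ A, (X * C (v i))).coeff k
      = ∑ A ∈ S.filter (fun A => A.card = k), ∏ i ∈ A, v i := by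
  rw [finset_sum_coeff, sum_filter]
  refine sum_congr rfl fun A _ => ?_
  rw [prod_mul_distrib, prod_const, ← map_prod, coeff_mul_C, coeff_X_pow]
  by_cases h : A.card = k
  · simp [h]
  · simp [h, Ne.symm h]

lemma main_poly (M : ℕ) :
    sparseSum (fun i => X * C ((2 * ((M + 1 : ℕ) : ℤ) - 1) ^ 2 - (2 * i - 1) ^ 2)) (-(M : ℤ)) (2 * M)
      = ∏ j ∈ Icc (1 : ℤ) M, (1 + X * C ((4 * j) ^ 2)) := by
  apply Polynomial.eq_of_infinite_eval_eq
  have hinf : (Set.range fun z : ℕ => -(z : ℤ) ^ 2).Infinite := by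
    apply Set.infinite_range_of_injective
    intro a b h
    simp only [neg_inj] at h
    have h' : a ^ 2 = b ^ 2 := by exact_mod_cast h
    exact Nat.pow_left_injective (by norm_num : 2 ≠ 0) h'
  refine hinf.mono ?_
  rintro _ ⟨z, rfl⟩
  simp only [Set.mem_setOf_eq]
  rw [eval_sparseSum, sparseSum_kacK ((2 * M + 1 : ℕ) : ℤ) (-(M : ℤ)) z, kacK_prod]
  · have := kacK_odd M 1 (2 * z)
    rw [one_mul] at this
    have e : ∏ i ∈ range (2 * M + 1), ((1 : ℤ) + (((2 * M + 1 : ℕ) : ℤ) - 1 - 2 * i) * (2 * z))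
        = ∏ i ∈ range (2 * M + 1), (1 + (2 * (M : ℤ) - 2 * i) * (2 * z)) :=
      prod_congr rfl fun i _ => by push_cast; ring
    rw [e, this, eval_prod]
    refine prod_bij (fun j _ => (j : ℤ) + 1) ?_ ?_ ?_ ?_
    · intro j hj
      have := mem_range.1 hj
      exact mem_Icc.2 (by omega)
    · intro i _ j _ h; simpa using h
    · intro b hb
      have := mem_Icc.1 hb
      exact ⟨(b - 1).toNat, mem_range.2 (by omega), by omega⟩
    · intro j _
      simp
      ring
  · intro p
    push_cast
    ring

/-- Proposition 2(b): for `1 ≤ k ≤ m - 1`, the sum of `∏_{s=1}^k ((2m-1)² - (2 i_s - 1)²)` over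
all sets `{i₁ < ⋯ < i_k}` of integers with `-m + 1 < i₁ < ⋯ < i_k < m` that are pairwise at
distance `≥ 2` equals the sum of `∏_{s=1}^k (4 j_s)²` over all sets
`{j₁ < ⋯ < j_k} ⊆ {1, …, m - 1}`. -/
theorem proposition2b (k m : ℕ) (hk : 1 ≤ k) (hkm : k ≤ m - 1) :
    (∑ A ∈ ((Finset.Ioo (-(m : ℤ) + 1) (m : ℤ)).powersetCard k).filter
        (fun A => ∀ i ∈ A, ∀ j ∈ A, i ≠ j → 2 ≤ |i - j|),
        ∏ i ∈ A, ((2 * (m : ℤ) - 1) ^ 2 - (2 * i - 1) ^ 2))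
      = ∑ B ∈ (Finset.Icc (1 : ℤ) ((m : ℤ) - 1)).powersetCard k,
          ∏ j ∈ B, (4 * j) ^ 2 := by
  obtain ⟨M, rfl⟩ : ∃ M, m = M + 1 := ⟨m - 1, by omega⟩
  have h := congrArg (fun p => p.coeff k) (main_poly M)
  simp only [prod_one_add] at h
  unfold sparseSum at h
  rw [coeff_sum_prod, coeff_sum_prod] at h
  have e1 : Ioo (-((M + 1 : ℕ) : ℤ) + 1) ((M + 1 : ℕ) : ℤ)
      = Ioo (-(M : ℤ)) (-(M : ℤ) + (2 * M : ℕ) + 1) := by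
    congr 1 <;> push_cast <;> ring
  have e2 : Icc (1 : ℤ) (((M + 1 : ℕ) : ℤ) - 1) = Icc (1 : ℤ) M := by
    congr 1; push_cast; ring
  rw [e1, e2]
  have e3 : (Icc (1 : ℤ) M).powersetCard k = (Icc (1 : ℤ) M).powerset.filter (fun A => A.card = k) := by
    ext A; simp [mem_powersetCard]
  rw [e3, ← h]
  refine sum_congr ?_ fun _ _ => rfl
  ext A
  simp only [mem_filter, mem_powersetCard, mem_powerset, SparseSet]
  tauto
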